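/- Let d ≥ 1 and n ≥ 1 be integers and let 0 < α < 1. There exists a constant c = c(n,d,α) ≥ 1 such that for every positive Borel measure μ on ℝ^d: c^{-1} · ∭ p_{α,1}(x,y,z) dμ(x)dμ(y)dμ(z) ≤ ∭ p_{α,n}(x,y,z) dμ(x)dμ(y)dμ(z) ≤ c · ∭ p_{α,1}(x,y,z) dμ(x)dμ(y)dμ(z), where the triple integrals (with values in [0,∞]) are taken over triples of pairwise distinct points (the integrand being set to 0 on triples that are not pairwise distinct). -/

import Mathlib

open scoped BigOperators

/-- The kernel `K^i_{α,n}(x) = x_i^{2n-1} / |x|^{2n-1+α}`. -/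
noncomputable def Kker (d n : ℕ) (α : ℝ) (i : Fin d) (x : EuclideanSpace ℝ (Fin d)) : ℝ :=
  (x i) ^ (2 * n - 1) / ‖x‖ ^ (2 * (n : ℝ) - 1 + α)

/-- The symmetrization (permutation) `p^i_{α,n}(x,y,z)`. -/
noncomputable def permI (d n : ℕ) (α : ℝ) (i : Fin d)
    (x y z : EuclideanSpace ℝ (Fin d)) : ℝ :=
  Kker d n α i (x - y) * Kker d n α i (x - z) +
    Kker d n α i (y - x) * Kker d n α i (y - z) +
    Kker d n α i (z - x) * Kker d n α i (z - y)

open Classical MeasureTheory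

/-- `p_{α,n}(x,y,z) = Σ_{i=1}^d p^i_{α,n}(x,y,z)`, set to `0` on triples which are not
pairwise distinct. -/
noncomputable def permTot (d n : ℕ) (α : ℝ) (x y z : EuclideanSpace ℝ (Fin d)) : ℝ :=
  if x ≠ y ∧ y ≠ z ∧ x ≠ z then ∑ i : Fin d, permI d n α i x y z else 0

/-- The triple integral `∭ p_{α,n}(x,y,z) dμ(x)dμ(y)dμ(z)`, valued in `[0,∞]`. -/
noncomputable def tripleEnergy (d n : ℕ) (α : ℝ) (μ : Measure (EuclideanSpace ℝ (Fin d))) :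
    ENNReal :=
  ∫⁻ x, ∫⁻ y, ∫⁻ z, ENNReal.ofReal (permTot d n α x y z) ∂μ ∂μ ∂μ

/-- The symmetrization of the scalar kernel `s ^ m / A ^ β` at three real points, where `A`, `B`,
`C` play the role of the distances between the first and second, second and third, first and
third point. -/
noncomputable def scalarPerm (m : ℕ) (β x y z A B C : ℝ) : ℝ :=
  (x - y) ^ m / A ^ β * ((x - z) ^ m / C ^ β) + (y - x) ^ m / A ^ β * ((y - z) ^ m / B ^ β) +
    (z - x) ^ m / C ^ β * ((z - y) ^ m / B ^ β)

lemma scalarPerm_swap_fst_snd (m : ℕ) (β x y z A B C : ℝ) :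
    scalarPerm m β x y z A B C = scalarPerm m β y x z A C B := by
  unfold scalarPerm; ring

lemma scalarPerm_swap_snd_trd (m : ℕ) (β x y z A B C : ℝ) :
    scalarPerm m β x y z A B C = scalarPerm m β x z y C B A := by
  unfold scalarPerm; ring

lemma scalarPerm_swap_fst_trd (m : ℕ) (β x y z A B C : ℝ) :
    scalarPerm m β x y z A B C = scalarPerm m β z y x B A C := by
  unfold scalarPerm; ring

lemma scalarPerm_eq_of_odd {m : ℕ} (hm : Odd m) (β x y z A B C : ℝ) :
    scalarPerm m β x y z A B C =
      (y - x) ^ m / A ^ β * ((z - x) ^ m / C ^ β) +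
        (z - y) ^ m / B ^ β * ((z - x) ^ m / C ^ β) -
        (y - x) ^ m / A ^ β * ((z - y) ^ m / B ^ β) := by
  unfold scalarPerm
  rw [← neg_sub y x, ← neg_sub z x, ← neg_sub z y, hm.neg_pow, hm.neg_pow, hm.neg_pow]
  ring

lemma pow_mul_tangent_le_pow_succ (m : ℕ) {p s : ℝ} (hp : 0 ≤ p) (hs : 0 < s) :
    s ^ m * (s + (m + 1) * (p - s)) ≤ p ^ (m + 1) := by
  have h := one_add_mul_le_pow (a := p / s - 1) (by have := div_nonneg hp hs.le; linarith) (m + 1)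
  have h2 : s ^ (m + 1) * (1 + ((m + 1 : ℕ) : ℝ) * (p / s - 1)) ≤
      s ^ (m + 1) * (1 + (p / s - 1)) ^ (m + 1) := by gcongr
  rw [← mul_pow] at h2
  have e1 : s * (1 + (p / s - 1)) = p := by field_simp; ring
  have e2 : s ^ (m + 1) * (1 + ((m + 1 : ℕ) : ℝ) * (p / s - 1)) =
      s ^ m * (s + (m + 1) * (p - s)) := by
    push_cast; field_simp; ring
  rwa [e1, e2] at h2

lemma one_le_rpow_add_mul_rpow {γ a b : ℝ} (hγ0 : 0 < γ) (hγ1 : γ < 1) (hb : 0 < b)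
    (hba : b ≤ a) (hab : 1 ≤ a + b) : 1 ≤ a ^ γ + ((2 : ℝ) ^ γ - 1) * b ^ γ := by
  have h2 : (1 : ℝ) ≤ 2 ^ γ := Real.one_le_rpow (by norm_num) hγ0.le
  have hinv : (2 : ℝ) ^ γ * (1 / 2 : ℝ) ^ γ = 1 := by
    rw [← Real.mul_rpow (by norm_num) (by norm_num)]; norm_num
  rcases le_total b (1 / 2) with hb2 | hb2
  · have hc := (Real.concaveOn_rpow hγ0.le hγ1.le).2 (Set.mem_Ici.2 zero_le_one)
      (Set.mem_Ici.2 one_half_pos.le) (show 0 ≤ 1 - 2 * b by linarith)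
      (show 0 ≤ 2 * b by linarith) (by ring)
    simp only [smul_eq_mul, Real.one_rpow] at hc
    have e : (1 - 2 * b) * 1 + 2 * b * (1 / 2) = 1 - b := by ring
    rw [e] at hc
    have h3 : (1 - b) ^ γ ≤ a ^ γ := Real.rpow_le_rpow (by linarith) (by linarith) hγ0.le
    have h4 : 2 * b ≤ 2 ^ γ * b ^ γ := by
      rw [← Real.mul_rpow (by norm_num) hb.le]
      have := Real.rpow_le_rpow_of_exponent_ge (x := 2 * b) (by linarith) (by linarith) hγ1.le
      rwa [Real.rpow_one] at this
    have h5 : (1 - (1 / 2 : ℝ) ^ γ) * (2 * b) ≤ (1 - (1 / 2 : ℝ) ^ γ) * (2 ^ γ * b ^ γ) := by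
      apply mul_le_mul_of_nonneg_left h4
      have : (1 / 2 : ℝ) ^ γ ≤ 1 := Real.rpow_le_one (by norm_num) (by norm_num) hγ0.le
      linarith
    have h6 : (1 - (1 / 2 : ℝ) ^ γ) * (2 ^ γ * b ^ γ) = (2 ^ γ - 1) * b ^ γ := by
      linear_combination (-b ^ γ) * hinv
    linarith
  · have h3 : (1 / 2 : ℝ) ^ γ ≤ b ^ γ := Real.rpow_le_rpow (by norm_num) hb2 hγ0.le
    have h4 : b ^ γ ≤ a ^ γ := Real.rpow_le_rpow hb.le hba hγ0.le
    nlinarith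

/-- The gain in the strict form of the subadditivity of `(a, s) ↦ a ^ (m + α) / s ^ m`. -/
noncomputable def radonGain (m : ℕ) (α : ℝ) : ℝ :=
  1 - ((2 : ℝ) ^ ((m + α) / (m + 1)) - 1) ^ (m + 1)

lemma exponent_ratio_mem {m : ℕ} {α : ℝ} (hα0 : 0 < α) (hα1 : α < 1) :
    0 < (m + α) / (m + 1) ∧ (m + α) / (m + 1) < 1 :=
  ⟨by positivity, by rw [div_lt_one (by positivity)]; linarith⟩

lemma radonGain_pos (m : ℕ) {α : ℝ} (hα0 : 0 < α) (hα1 : α < 1) : 0 < radonGain m α := by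
  obtain ⟨h0, h1⟩ := exponent_ratio_mem (m := m) hα0 hα1
  have h2 : (1 : ℝ) ≤ 2 ^ ((m + α) / (m + 1)) := Real.one_le_rpow (by norm_num) h0.le
  have h3 : (2 : ℝ) ^ ((m + α) / (m + 1)) < 2 := by
    simpa using Real.rpow_lt_rpow_of_exponent_lt (x := 2) (by norm_num) h1
  have := pow_lt_one₀ (a := (2 : ℝ) ^ ((m + α) / (m + 1)) - 1) (by linarith) (by linarith)
    m.add_one_ne_zero
  unfold radonGain
  linarith

lemma radonGain_le_one (m : ℕ) {α : ℝ} (hα0 : 0 < α) (hα1 : α < 1) : radonGain m α ≤ 1 := by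
  obtain ⟨h0, -⟩ := exponent_ratio_mem (m := m) hα0 hα1
  have h2 : (1 : ℝ) ≤ 2 ^ ((m + α) / (m + 1)) := Real.one_le_rpow (by norm_num) h0.le
  have := pow_nonneg (a := (2 : ℝ) ^ ((m + α) / (m + 1)) - 1) (by linarith) (m + 1)
  unfold radonGain
  linarith

lemma radonGain_mul_le {m : ℕ} {α s t a b : ℝ} (hα0 : 0 < α) (hα1 : α < 1)
    (hs : 0 < s) (ht : 0 < t) (hst : s + t = 1) (hb : 0 < b) (hba : b ≤ a)
    (hab : 1 ≤ a + b) :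
    radonGain m α * (s ^ m / a ^ (m + α)) ≤
      s ^ m / a ^ (m + α) + t ^ m / b ^ (m + α) -
        s ^ m / a ^ (m + α) * (t ^ m / b ^ (m + α)) := by
  obtain ⟨h0, h1⟩ := exponent_ratio_mem (m := m) hα0 hα1
  have ha : 0 < a := hb.trans_le hba
  have hsum := one_le_rpow_add_mul_rpow h0 h1 hb hba hab
  have hpow : ∀ w : ℝ, 0 < w → (w ^ ((m + α) / (m + 1))) ^ (m + 1) = w ^ (m + α) := by
    intro w hw
    rw [← Real.rpow_natCast, ← Real.rpow_mul hw.le]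
    congr 1
    push_cast
    field_simp
  have h2 : (1 : ℝ) ≤ 2 ^ ((m + α) / (m + 1)) := Real.one_le_rpow (by norm_num) h0.le
  set κ := (2 : ℝ) ^ ((m + α) / (m + 1)) - 1 with hκ
  have hg : radonGain m α = 1 - κ ^ (m + 1) := rfl
  have hp := pow_mul_tangent_le_pow_succ m (p := a ^ ((m + α) / (m + 1))) (by positivity) hs
  have hr := pow_mul_tangent_le_pow_succ m (p := κ * b ^ ((m + α) / (m + 1)))
    (mul_nonneg (by linarith) (by positivity)) ht
  rw [mul_pow, hpow b hb] at hr
  rw [hpow a ha] at hp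
  have hA : 0 < a ^ (m + α) := by positivity
  have hB : 0 < b ^ (m + α) := by positivity
  have hS : 0 < s ^ m := by positivity
  have hT : 0 < t ^ m := by positivity
  rw [hg]
  generalize a ^ (m + α) = P at *
  generalize b ^ (m + α) = Q at *
  generalize s ^ m = S at *
  generalize t ^ m = T at *
  generalize κ ^ (m + 1) = k at *
  generalize a ^ ((m + α) / (m + 1)) = p at *
  generalize κ * b ^ ((m + α) / (m + 1)) = r at *
  have hp' : s + (m + 1) * (p - s) ≤ P / S := by rw [le_div_iff₀ hS]; linarith
  have hr' : t + (m + 1) * (r - t) ≤ k * Q / T := by rw [le_div_iff₀ hT]; linarith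
  have hone : 1 ≤ P / S + k * Q / T := by
    have : 0 ≤ ((m : ℝ) + 1) * (p + r - 1) := mul_nonneg (by positivity) (by linarith)
    have e : s + (m + 1) * (p - s) + (t + (m + 1) * (r - t)) =
      1 + ((m : ℝ) + 1) * (p + r - 1) := by linear_combination (-(m : ℝ)) * hst
    linarith
  have hXY : 0 < S / P * (T / Q) := by positivity
  have := mul_le_mul_of_nonneg_left hone hXY.le
  have e : S / P * (T / Q) * (P / S + k * Q / T) = T / Q + k * (S / P) := by
    field_simp
  rw [e] at this
  linarith

/-- The constant in the lower bound for `scalarPerm`. -/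
noncomputable def lowerConst (m : ℕ) (α : ℝ) : ℝ := min (radonGain m α) ((1 / 2) ^ m)

lemma lowerConst_pos (m : ℕ) {α : ℝ} (hα0 : 0 < α) (hα1 : α < 1) : 0 < lowerConst m α :=
  lt_min (radonGain_pos m hα0 hα1) (by positivity)

lemma lowerConst_div_le {m : ℕ} {α s t a b R : ℝ} (hα0 : 0 < α) (hα1 : α < 1) (hm : m ≠ 0)
    (hs : 0 ≤ s) (ht : 0 ≤ t) (hst : s + t = 1) (ha : 0 < a) (hb : 0 < b)
    (hab : 1 ≤ a + b) (haR : a ≤ R) (hbR : b ≤ R) (hR : 1 ≤ R) :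
    lowerConst m α / R ^ (m + α) ≤
      s ^ m / a ^ (m + α) + t ^ m / b ^ (m + α) -
        s ^ m / a ^ (m + α) * (t ^ m / b ^ (m + α)) := by
  have hc0 := lowerConst_pos m hα0 hα1
  have hβ : 0 < m + α := by positivity
  have hg : lowerConst m α ≤ radonGain m α := min_le_left _ _
  have hh : lowerConst m α ≤ (1 / 2) ^ m := min_le_right _ _
  have hc1 : lowerConst m α / R ^ (m + α) ≤ lowerConst m α :=
    div_le_self hc0.le (Real.one_le_rpow hR hβ.le)
  have hc2 := hc1.trans (hg.trans (radonGain_le_one m hα0 hα1))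
  have hpos : ∀ w : ℝ, 0 ≤ w → 1 < w ^ m / a ^ (m + α) ∨ 1 < w ^ m / b ^ (m + α) → 0 < w := by
    intro w hw h
    rcases hw.eq_or_lt with rfl | h'
    · simp [hm] at h; norm_num at h
    · exact h'
  rcases le_or_gt (s ^ m / a ^ (m + α)) 1 with hX | hX <;>
    rcases le_or_gt (t ^ m / b ^ (m + α)) 1 with hY | hY
  · have hX0 : 0 ≤ s ^ m / a ^ (m + α) := by positivity
    have hY0 : 0 ≤ t ^ m / b ^ (m + α) := by positivity
    have key : ∀ w e : ℝ, 1 / 2 ≤ w → 0 < e → e ≤ R →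
        lowerConst m α / R ^ (m + α) ≤ w ^ m / e ^ (m + α) := by
      intro w e hw he heR
      apply div_le_div₀ (by positivity) _ (by positivity)
        (Real.rpow_le_rpow he.le heR hβ.le)
      exact hh.trans (pow_le_pow_left₀ (by norm_num) hw m)
    rcases le_total (1 / 2) s with h | h
    · have := key s a h ha haR
      nlinarith
    · have := key t b (by linarith) hb hbR
      nlinarith
  · nlinarith
  · nlinarith
  · have hs' := hpos s hs (.inl hX)
    have ht' := hpos t ht (.inr hY)
    have hg0 := radonGain_pos m hα0 hα1
    rcases le_total b a with h | h
    · have := radonGain_mul_le (m := m) hα0 hα1 hs' ht' hst hb h hab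
      nlinarith
    · have := radonGain_mul_le (m := m) hα0 hα1 ht' hs' (by linarith) ha h (by linarith)
      nlinarith

lemma lowerConst_mul_le_scalarPerm_of_sorted {m : ℕ} {α x y z A B C L v : ℝ}
    (hα0 : 0 < α) (hα1 : α < 1) (hm : Odd m) (hxy : x ≤ y) (hyz : y ≤ z)
    (hA : 0 < A) (hB : 0 < B) (hC : 0 < C) (hAL : A ≤ L) (hBL : B ≤ L) (hCL : C ≤ L)
    (htri : C ≤ A + B) (hv : |v| ≤ z - x) :
    lowerConst m α * (v ^ m / L ^ (m + α)) ^ 2 ≤ scalarPerm m (m + α) x y z A B C := by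
  have hc0 := lowerConst_pos m hα0 hα1
  have hL : 0 < L := hA.trans_le hAL
  have hβ : 0 < m + α := by positivity
  rcases (hxy.trans hyz).eq_or_lt with hxz | hxz
  · have e1 : y = x := le_antisymm (hyz.trans hxz.ge) hxy
    have e2 : v = 0 := by simpa [hxz] using hv
    subst e1 e2 hxz
    simp [scalarPerm, hm.pos.ne']
  have hu : 0 < z - x := sub_pos.2 hxz
  have hE := lowerConst_div_le (m := m) (s := (y - x) / (z - x)) (t := (z - y) / (z - x))
    (a := A / C) (b := B / C) (R := L / C) hα0 hα1 hm.pos.ne'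
    (div_nonneg (by linarith) hu.le) (div_nonneg (by linarith) hu.le)
    (by rw [← add_div, div_eq_one_iff_eq hu.ne']; ring) (by positivity) (by positivity)
    (by rw [← add_div, one_le_div hC]; exact htri) (by gcongr) (by gcongr)
    (by rwa [one_le_div hC])
  rw [Real.div_rpow hA.le hC.le, Real.div_rpow hB.le hC.le, Real.div_rpow hL.le hC.le,
    div_pow, div_pow] at hE
  have hv2 : (v ^ m) ^ 2 ≤ ((z - x) ^ m) ^ 2 := by
    rw [← sq_abs (v ^ m), abs_pow]
    gcongr
  have hCL' : C ^ (m + α) ≤ L ^ (m + α) := Real.rpow_le_rpow hC.le hCL hβ.le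
  rw [scalarPerm_eq_of_odd hm]
  have hP : 0 < A ^ (m + α) := by positivity
  have hQ : 0 < B ^ (m + α) := by positivity
  have hW : 0 < C ^ (m + α) := by positivity
  have hLL : 0 < L ^ (m + α) := by positivity
  have hU : 0 < (z - x) ^ m := by positivity
  generalize A ^ (m + α) = P at *
  generalize B ^ (m + α) = Q at *
  generalize C ^ (m + α) = W at *
  generalize L ^ (m + α) = Λ at *
  generalize (z - x) ^ m = U at *
  generalize (y - x) ^ m = S at *
  generalize (z - y) ^ m = T at *
  generalize v ^ m = V at *
  generalize lowerConst m α = c at *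
  have h1 := mul_le_mul_of_nonneg_left hE (sq_nonneg (U / W))
  have e1 : (U / W) ^ 2 * (S / U / (P / W) + T / U / (Q / W) - S / U / (P / W) * (T / U / (Q / W)))
      = S / P * (U / W) + T / Q * (U / W) - S / P * (T / Q) := by field_simp
  have e2 : (U / W) ^ 2 * (c / (Λ / W)) = c * (U ^ 2 / (W * Λ)) := by field_simp
  rw [e1, e2] at h1
  refine le_trans ?_ h1
  rw [div_pow]
  gcongr
  nlinarith

lemma lowerConst_mul_le_scalarPerm {m : ℕ} {α x y z A B C L : ℝ}
    (hα0 : 0 < α) (hα1 : α < 1) (hm : Odd m)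
    (hA : 0 < A) (hB : 0 < B) (hC : 0 < C) (hAL : A ≤ L) (hBL : B ≤ L) (hCL : C ≤ L)
    (hCtri : C ≤ A + B) (hAtri : A ≤ B + C) (hBtri : B ≤ A + C) :
    lowerConst m α * ((x - z) ^ m / L ^ (m + α)) ^ 2 ≤ scalarPerm m (m + α) x y z A B C := by
  rcases le_total x y with h1 | h1 <;> rcases le_total y z with h2 | h2 <;>
    rcases le_total x z with h3 | h3
  · exact lowerConst_mul_le_scalarPerm_of_sorted hα0 hα1 hm h1 h2 hA hB hC hAL hBL hCL hCtri
      (by rw [abs_le]; constructor <;> linarith)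
  · exact lowerConst_mul_le_scalarPerm_of_sorted hα0 hα1 hm h1 h2 hA hB hC hAL hBL hCL hCtri
      (by rw [abs_le]; constructor <;> linarith)
  · rw [scalarPerm_swap_snd_trd]
    exact lowerConst_mul_le_scalarPerm_of_sorted hα0 hα1 hm h3 h2 hC hB hA hCL hBL hAL
      (by linarith) (by rw [abs_le]; constructor <;> linarith)
  · rw [scalarPerm_swap_snd_trd, scalarPerm_swap_fst_snd]
    exact lowerConst_mul_le_scalarPerm_of_sorted hα0 hα1 hm h3 h1 hC hA hB hCL hAL hBL
      (by linarith) (by rw [abs_le]; constructor <;> linarith)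
  · rw [scalarPerm_swap_fst_snd]
    exact lowerConst_mul_le_scalarPerm_of_sorted hα0 hα1 hm h1 h3 hA hC hB hAL hCL hBL
      (by linarith) (by rw [abs_le]; constructor <;> linarith)
  · rw [scalarPerm_swap_fst_snd, scalarPerm_swap_snd_trd]
    exact lowerConst_mul_le_scalarPerm_of_sorted hα0 hα1 hm h2 h3 hB hC hA hBL hCL hAL
      (by linarith) (by rw [abs_le]; constructor <;> linarith)
  · rw [scalarPerm_swap_fst_trd]
    exact lowerConst_mul_le_scalarPerm_of_sorted hα0 hα1 hm h2 h1 hB hA hC hBL hAL hCL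
      (by linarith) (by rw [abs_le]; constructor <;> linarith)
  · rw [scalarPerm_swap_fst_trd]
    exact lowerConst_mul_le_scalarPerm_of_sorted hα0 hα1 hm h2 h1 hB hA hC hBL hAL hCL
      (by linarith) (by rw [abs_le]; constructor <;> linarith)

lemma pow_div_rpow_add {m : ℕ} {α A : ℝ} (hA : 0 < A) : A ^ m / A ^ (m + α) = A ^ (-α) := by
  rw [← Real.rpow_natCast A m, ← Real.rpow_sub hA]
  congr 1
  ring

lemma abs_pow_div_rpow_le {m : ℕ} {α s A : ℝ} (hA : 0 < A) (hs : |s| ≤ A) :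
    |s ^ m / A ^ (m + α)| ≤ A ^ (-α) := by
  rw [← pow_div_rpow_add (m := m) hA, abs_div, abs_pow,
    abs_of_pos (by positivity : 0 < A ^ (m + α))]
  gcongr

lemma abs_kernel_sub_le {m : ℕ} {α s u A B C : ℝ} (hα0 : 0 < α) (hm : 1 ≤ m)
    (hA : 0 < A) (hAC : A ≤ C) (htri : C ≤ A + B)
    (hs : |s| ≤ A) (hu : |u| ≤ C) (hus : |u - s| ≤ B) :
    |u ^ m / C ^ (m + α) - s ^ m / A ^ (m + α)| ≤ (m + (m + α)) * (A ^ (-α) * (B / C)) := by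
  have hC : 0 < C := hA.trans_le hAC
  have hB : 0 ≤ B := (abs_nonneg _).trans hus
  have hβ : 1 ≤ m + α := by
    have : (1 : ℝ) ≤ m := by exact_mod_cast hm
    linarith
  have h1 : |u ^ m / C ^ (m + α) - s ^ m / C ^ (m + α)| ≤ m * (A ^ (-α) * (B / C)) := by
    rw [← sub_div, abs_div, abs_of_pos (by positivity : 0 < C ^ (m + α))]
    have h2 : |u ^ m - s ^ m| ≤ B * m * C ^ (m - 1) := by
      refine (abs_pow_sub_pow_le u s m).trans ?_
      gcongr
      exact max_le hu (hs.trans hAC)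
    have h3 : C ^ (-α) ≤ A ^ (-α) := Real.rpow_le_rpow_of_nonpos hA hAC (by linarith)
    calc |u ^ m - s ^ m| / C ^ (m + α) ≤ B * m * C ^ (m - 1) / C ^ (m + α) := by gcongr
      _ = m * (C ^ m / C ^ (m + α) * (B / C)) := by
        obtain ⟨k, rfl⟩ := Nat.exists_eq_add_of_le' hm
        simp only [Nat.add_sub_cancel, pow_succ]
        field_simp
      _ ≤ m * (A ^ (-α) * (B / C)) := by
        rw [pow_div_rpow_add hC]
        gcongr
  have h4 : |s ^ m / C ^ (m + α) - s ^ m / A ^ (m + α)| ≤ (m + α) * (A ^ (-α) * (B / C)) := by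
    have e : s ^ m / C ^ (m + α) - s ^ m / A ^ (m + α) =
        -(s ^ m / A ^ (m + α) * (1 - (A / C) ^ (m + α))) := by
      rw [Real.div_rpow hA.le hC.le]
      have : 0 < A ^ (m + α) := by positivity
      have : 0 < C ^ (m + α) := by positivity
      field_simp
      ring
    have hAC1 : A / C ≤ 1 := by rwa [div_le_one hC]
    have hAC0 : 0 < A / C := by positivity
    have h5 : 1 - (A / C) ^ (m + α) ≤ (m + α) * (B / C) := by
      have := one_add_mul_self_le_rpow_one_add (s := A / C - 1) (by linarith) hβ
      rw [add_sub_cancel] at this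
      have h6 : 1 - A / C ≤ B / C := by
        rw [sub_le_iff_le_add, ← add_div, one_le_div hC]; linarith
      nlinarith
    have h7 : 0 ≤ 1 - (A / C) ^ (m + α) :=
      sub_nonneg.2 (Real.rpow_le_one hAC0.le hAC1 (by linarith))
    rw [e, abs_neg, abs_mul, abs_of_nonneg h7]
    calc _ ≤ A ^ (-α) * ((m + α) * (B / C)) :=
          mul_le_mul (abs_pow_div_rpow_le hA hs) h5 h7 (by positivity)
      _ = _ := by ring
  calc _ ≤ |u ^ m / C ^ (m + α) - s ^ m / C ^ (m + α)| +
        |s ^ m / C ^ (m + α) - s ^ m / A ^ (m + α)| := abs_sub_le _ _ _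
    _ ≤ _ := by linarith

lemma scalarPerm_le_of_le {m : ℕ} {α x y z A B C : ℝ} (hα0 : 0 < α) (hα1 : α < 1) (hm : Odd m)
    (hA : 0 < A) (hB : 0 < B) (hBA : B ≤ A) (hAC : A ≤ C) (htri : C ≤ A + B)
    (hxy : |x - y| ≤ A) (hyz : |y - z| ≤ B) (hxz : |x - z| ≤ C) :
    scalarPerm m (m + α) x y z A B C ≤ 4 * (1 + (m + (m + α))) * (C ^ (-α)) ^ 2 := by
  have hC : 0 < C := hA.trans_le hAC
  rw [abs_sub_comm] at hxy hyz hxz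
  rw [scalarPerm_eq_of_odd hm]
  have hd := abs_kernel_sub_le (m := m) hα0 hm.pos hA hAC htri hxy hxz
    (by rwa [sub_sub_sub_cancel_right])
  have ka := abs_pow_div_rpow_le (m := m) (α := α) hA hxy
  have kb := abs_pow_div_rpow_le (m := m) (α := α) hB hyz
  have kc := abs_pow_div_rpow_le (m := m) (α := α) hC hxz
  have hCA : C ^ (-α) ≤ A ^ (-α) := Real.rpow_le_rpow_of_nonpos hA hAC (by linarith)
  have hBB : B ^ (-α) * (B / C) ≤ A ^ (-α) := by
    have e : ∀ w : ℝ, 0 < w → w ^ (-α) * w = w ^ (1 - α) := by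
      intro w hw
      rw [← Real.rpow_add_one hw.ne']
      congr 1
      ring
    have : B ^ (1 - α) ≤ A ^ (1 - α) := Real.rpow_le_rpow hB.le hBA (by linarith)
    rw [← mul_div_assoc, e B hB, div_le_iff₀ hC]
    calc _ ≤ A ^ (1 - α) := this
      _ = A ^ (-α) * A := (e A hA).symm
      _ ≤ _ := by gcongr
  have hAC2 : A ^ (-α) ≤ 2 * C ^ (-α) := by
    have h1 : A ^ (-α) ≤ (C / 2) ^ (-α) :=
      Real.rpow_le_rpow_of_nonpos (by positivity) (by linarith) (by linarith)
    have h2 : (C / 2) ^ (-α) = 2 ^ α * C ^ (-α) := by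
      rw [Real.div_rpow hC.le (by norm_num), Real.rpow_neg (by norm_num : (0 : ℝ) ≤ 2)]
      field_simp
    have h3 : (2 : ℝ) ^ α ≤ 2 := by
      simpa using Real.rpow_le_rpow_of_exponent_le (x := 2) (by norm_num) hα1.le
    rw [h2] at h1
    exact h1.trans (by gcongr)
  have hAp : 0 < A ^ (-α) := by positivity
  have hBp : 0 < B ^ (-α) := by positivity
  have hm' : 0 < (m : ℝ) + (m + α) := by positivity
  generalize (y - x) ^ m / A ^ (m + α) = Ka at *
  generalize (z - y) ^ m / B ^ (m + α) = Kb at *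
  generalize (z - x) ^ m / C ^ (m + α) = Kc at *
  have t1 : Ka * Kc ≤ A ^ (-α) * A ^ (-α) := by
    calc _ ≤ |Ka| * |Kc| := by rw [← abs_mul]; exact le_abs_self _
      _ ≤ _ := by gcongr; exact kc.trans hCA
  have t2 : Kb * (Kc - Ka) ≤ (m + (m + α)) * (A ^ (-α) * A ^ (-α)) := by
    calc _ ≤ |Kb| * |Kc - Ka| := by rw [← abs_mul]; exact le_abs_self _
      _ ≤ B ^ (-α) * ((m + (m + α)) * (A ^ (-α) * (B / C))) := by gcongr
      _ = (m + (m + α)) * (A ^ (-α) * (B ^ (-α) * (B / C))) := by ring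
      _ ≤ _ := by gcongr
  calc _ = Ka * Kc + Kb * (Kc - Ka) := by ring
    _ ≤ (1 + (m + (m + α))) * (A ^ (-α) * A ^ (-α)) := by linarith
    _ ≤ (1 + (m + (m + α))) * (2 * C ^ (-α) * (2 * C ^ (-α))) := by gcongr
    _ = _ := by ring

lemma scalarPerm_le {m : ℕ} {α x y z A B C : ℝ} (hα0 : 0 < α) (hα1 : α < 1) (hm : Odd m)
    (hA : 0 < A) (hB : 0 < B) (hAC : A ≤ C) (hBC : B ≤ C) (htri : C ≤ A + B)
    (hxy : |x - y| ≤ A) (hyz : |y - z| ≤ B) (hxz : |x - z| ≤ C) :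
    scalarPerm m (m + α) x y z A B C ≤ 4 * (1 + (m + (m + α))) * (C ^ (-α)) ^ 2 := by
  rcases le_total B A with h | h
  · exact scalarPerm_le_of_le hα0 hα1 hm hA hB h hAC htri hxy hyz hxz
  · rw [scalarPerm_swap_fst_trd]
    rw [abs_sub_comm] at hxy hyz hxz
    exact scalarPerm_le_of_le hα0 hα1 hm hB hA h hBC (by linarith) hyz hxy hxz

lemma odd_two_mul_sub_one {n : ℕ} (hn : 1 ≤ n) : Odd (2 * n - 1) := ⟨n - 1, by omega⟩

lemma permI_eq_scalarPerm {d n : ℕ} (hn : 1 ≤ n) (α : ℝ) (i : Fin d)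
    (x y z : EuclideanSpace ℝ (Fin d)) :
    permI d n α i x y z = scalarPerm (2 * n - 1) ((2 * n - 1 : ℕ) + α) (x i) (y i) (z i)
      ‖x - y‖ ‖y - z‖ ‖x - z‖ := by
  have e : ((2 * n - 1 : ℕ) : ℝ) = 2 * (n : ℝ) - 1 := by
    rw [Nat.cast_sub (by omega)]; push_cast; ring
  simp only [permI, Kker, scalarPerm, e, norm_sub_rev y x, norm_sub_rev z x, norm_sub_rev z y,
    PiLp.sub_apply]

lemma permTot_swap_fst_snd (d n : ℕ) (α : ℝ) (x y z : EuclideanSpace ℝ (Fin d)) :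
    permTot d n α x y z = permTot d n α y x z := by
  unfold permTot
  refine if_congr (by grind) (Finset.sum_congr rfl fun i _ => ?_) rfl
  unfold permI; ring

lemma permTot_swap_snd_trd (d n : ℕ) (α : ℝ) (x y z : EuclideanSpace ℝ (Fin d)) :
    permTot d n α x y z = permTot d n α x z y := by
  unfold permTot
  refine if_congr (by grind) (Finset.sum_congr rfl fun i _ => ?_) rfl
  unfold permI; ring

lemma norm_pow_div_card_pow_le_sum {d : ℕ} (k : ℕ) (v : EuclideanSpace ℝ (Fin d)) :
    (‖v‖ ^ (2 * k + 1)) ^ 2 / (d : ℝ) ^ (2 * k) ≤ ∑ i, (v i ^ (2 * k + 1)) ^ 2 := by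
  have h := pow_sum_div_card_le_sum_pow (s := Finset.univ) (f := fun i => v i ^ 2)
    (fun i _ => sq_nonneg _) (2 * k)
  rw [← EuclideanSpace.real_norm_sq_eq, Finset.card_univ, Fintype.card_fin] at h
  simpa only [← pow_mul, mul_comm 2] using h

/-- The constant in the lower bound for `permTot`. -/
noncomputable def permLowerConst (d n : ℕ) (α : ℝ) : ℝ :=
  lowerConst (2 * n - 1) α / (d : ℝ) ^ (2 * n - 2)

/-- The constant in the upper bound for `permTot`. -/
noncomputable def permUpperConst (d n : ℕ) (α : ℝ) : ℝ :=
  d * (4 * (1 + ((2 * n - 1 : ℕ) + ((2 * n - 1 : ℕ) + α))))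

lemma permLowerConst_mul_le_permTot {d n : ℕ} (hn : 1 ≤ n) {α : ℝ} (hα0 : 0 < α) (hα1 : α < 1)
    {x y z : EuclideanSpace ℝ (Fin d)} (hxy : x ≠ y) (hyz : y ≠ z) (hxz : x ≠ z)
    (hAC : ‖x - y‖ ≤ ‖x - z‖) (hBC : ‖y - z‖ ≤ ‖x - z‖) :
    permLowerConst d n α * (‖x - z‖ ^ (-α)) ^ 2 ≤ permTot d n α x y z := by
  have hA : 0 < ‖x - y‖ := norm_pos_iff.2 (sub_ne_zero.2 hxy)
  have hB : 0 < ‖y - z‖ := norm_pos_iff.2 (sub_ne_zero.2 hyz)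
  have hC : 0 < ‖x - z‖ := norm_pos_iff.2 (sub_ne_zero.2 hxz)
  have hc := lowerConst_pos (2 * n - 1) hα0 hα1
  have hsum := norm_pow_div_card_pow_le_sum (n - 1) (x - z)
  rw [show 2 * (n - 1) + 1 = 2 * n - 1 by omega, show 2 * (n - 1) = 2 * n - 2 by omega] at hsum
  rw [permTot, if_pos ⟨hxy, hyz, hxz⟩, permLowerConst]
  calc _ = lowerConst (2 * n - 1) α / (‖x - z‖ ^ ((2 * n - 1 : ℕ) + α)) ^ 2 *
        ((‖x - z‖ ^ (2 * n - 1)) ^ 2 / (d : ℝ) ^ (2 * n - 2)) := by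
        rw [← pow_div_rpow_add (m := 2 * n - 1) hC, div_pow]
        ring
    _ ≤ lowerConst (2 * n - 1) α / (‖x - z‖ ^ ((2 * n - 1 : ℕ) + α)) ^ 2 *
        ∑ i, ((x - z) i ^ (2 * n - 1)) ^ 2 := by gcongr
    _ = ∑ i, lowerConst (2 * n - 1) α *
        ((x i - z i) ^ (2 * n - 1) / ‖x - z‖ ^ ((2 * n - 1 : ℕ) + α)) ^ 2 := by
        rw [Finset.mul_sum]
        refine Finset.sum_congr rfl fun i _ => ?_
        rw [div_pow, PiLp.sub_apply]
        ring
    _ ≤ _ := by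
        refine Finset.sum_le_sum fun i _ => ?_
        rw [permI_eq_scalarPerm hn]
        exact lowerConst_mul_le_scalarPerm hα0 hα1 (odd_two_mul_sub_one hn) hA hB hC hAC hBC le_rfl
          (norm_sub_le_norm_sub_add_norm_sub x y z) (by linarith) (by linarith)

lemma permTot_le_permUpperConst_mul {d n : ℕ} (hn : 1 ≤ n) {α : ℝ} (hα0 : 0 < α) (hα1 : α < 1)
    {x y z : EuclideanSpace ℝ (Fin d)} (hxy : x ≠ y) (hyz : y ≠ z) (hxz : x ≠ z)
    (hAC : ‖x - y‖ ≤ ‖x - z‖) (hBC : ‖y - z‖ ≤ ‖x - z‖) :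
    permTot d n α x y z ≤ permUpperConst d n α * (‖x - z‖ ^ (-α)) ^ 2 := by
  have hA : 0 < ‖x - y‖ := norm_pos_iff.2 (sub_ne_zero.2 hxy)
  have hB : 0 < ‖y - z‖ := norm_pos_iff.2 (sub_ne_zero.2 hyz)
  have hcoord : ∀ (v w : EuclideanSpace ℝ (Fin d)) (i : Fin d), |v i - w i| ≤ ‖v - w‖ :=
    fun v w i => by simpa using PiLp.norm_apply_le (v - w) i
  rw [permTot, if_pos ⟨hxy, hyz, hxz⟩, permUpperConst]
  calc _ ≤ ∑ _i : Fin d, 4 * (1 + (((2 * n - 1 : ℕ) : ℝ) + ((2 * n - 1 : ℕ) + α))) *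
        (‖x - z‖ ^ (-α)) ^ 2 := by
        refine Finset.sum_le_sum fun i _ => ?_
        rw [permI_eq_scalarPerm hn]
        exact scalarPerm_le hα0 hα1 (odd_two_mul_sub_one hn) hA hB hAC hBC
          (norm_sub_le_norm_sub_add_norm_sub x y z) (hcoord x y i) (hcoord y z i) (hcoord x z i)
    _ = _ := by
        rw [Finset.sum_const, Finset.card_univ, Fintype.card_fin, nsmul_eq_mul]
        ring

lemma exists_permTot_bounds {d : ℕ} {α : ℝ} (hα0 : 0 < α) (hα1 : α < 1)
    (x y z : EuclideanSpace ℝ (Fin d)) :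
    ∃ D : ℝ, 0 ≤ D ∧ ∀ n : ℕ, 1 ≤ n → permLowerConst d n α * D ≤ permTot d n α x y z ∧
      permTot d n α x y z ≤ permUpperConst d n α * D := by
  by_cases h : x ≠ y ∧ y ≠ z ∧ x ≠ z
  swap
  · exact ⟨0, le_rfl, fun n _ => by simp only [permTot, if_neg h, mul_zero, le_refl, and_self]⟩
  obtain ⟨hxy, hyz, hxz⟩ := h
  have key : ∀ {x y z : EuclideanSpace ℝ (Fin d)}, x ≠ y → y ≠ z → x ≠ z →
      ‖x - y‖ ≤ ‖x - z‖ → ‖y - z‖ ≤ ‖x - z‖ →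
      ∃ D : ℝ, 0 ≤ D ∧ ∀ n : ℕ, 1 ≤ n → permLowerConst d n α * D ≤ permTot d n α x y z ∧
        permTot d n α x y z ≤ permUpperConst d n α * D :=
    fun {x y z} hxy hyz hxz hAC hBC => ⟨(‖x - z‖ ^ (-α)) ^ 2, sq_nonneg _, fun n hn =>
      ⟨permLowerConst_mul_le_permTot hn hα0 hα1 hxy hyz hxz hAC hBC,
        permTot_le_permUpperConst_mul hn hα0 hα1 hxy hyz hxz hAC hBC⟩⟩
  rcases le_total ‖x - y‖ ‖x - z‖ with h1 | h1
  · rcases le_total ‖y - z‖ ‖x - z‖ with h2 | h2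
    · exact key hxy hyz hxz h1 h2
    · simp only [permTot_swap_fst_snd d _ α x y z]
      exact key hxy.symm hxz hyz (by rw [norm_sub_rev y x]; exact h1.trans h2) h2
  · rcases le_total ‖y - z‖ ‖x - y‖ with h2 | h2
    · simp only [permTot_swap_snd_trd d _ α x y z]
      exact key hxz hyz.symm hxy h1 (by rwa [norm_sub_rev z y])
    · simp only [permTot_swap_fst_snd d _ α x y z]
      exact key hxy.symm hxz hyz (by rwa [norm_sub_rev y x]) (h1.trans h2)

lemma permTot_le_mul_permTot {d n k : ℕ} (hd : 1 ≤ d) (hn : 1 ≤ n) (hk : 1 ≤ k) {α c : ℝ}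
    (hα0 : 0 < α) (hα1 : α < 1) (hc0 : 0 ≤ c)
    (hc : permUpperConst d n α / permLowerConst d k α ≤ c)
    (x y z : EuclideanSpace ℝ (Fin d)) :
    permTot d n α x y z ≤ c * permTot d k α x y z := by
  have hl : 0 < permLowerConst d k α := div_pos (lowerConst_pos _ hα0 hα1) (by positivity)
  rw [div_le_iff₀ hl] at hc
  obtain ⟨D, hD, h⟩ := exists_permTot_bounds hα0 hα1 x y z
  calc _ ≤ permUpperConst d n α * D := (h n hn).2
    _ ≤ c * permLowerConst d k α * D := by gcongr
    _ = c * (permLowerConst d k α * D) := mul_assoc _ _ _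
    _ ≤ _ := by gcongr; exact (h k hk).1

lemma tripleEnergy_le_mul {d n k : ℕ} {α : ℝ} {c : NNReal}
    (h : ∀ x y z : EuclideanSpace ℝ (Fin d), permTot d n α x y z ≤ c * permTot d k α x y z)
    (μ : Measure (EuclideanSpace ℝ (Fin d))) :
    tripleEnergy d n α μ ≤ (c : ENNReal) * tripleEnergy d k α μ := by
  unfold tripleEnergy
  simp only [← lintegral_const_mul' _ _ (ENNReal.coe_ne_top (r := c))]
  refine lintegral_mono fun x => lintegral_mono fun y => lintegral_mono fun z => ?_
  calc _ ≤ ENNReal.ofReal (c * permTot d k α x y z) := ENNReal.ofReal_le_ofReal (h x y z)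
    _ = _ := by rw [ENNReal.ofReal_mul c.coe_nonneg, ENNReal.ofReal_coe_nnreal]

/-- For `0 < α < 1` there is `c = c(n,d,α) ≥ 1` such that for every positive Borel
measure `μ` the triple integral of `p_{α,n}` is comparable to that of `p_{α,1}`. -/
theorem stmt13 (d n : ℕ) (hd : 1 ≤ d) (hn : 1 ≤ n) (α : ℝ) (hα0 : 0 < α) (hα1 : α < 1) :
    ∃ c : NNReal, 1 ≤ c ∧
      ∀ μ : Measure (EuclideanSpace ℝ (Fin d)),
        (c : ENNReal)⁻¹ * tripleEnergy d 1 α μ ≤ tripleEnergy d n α μ ∧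
          tripleEnergy d n α μ ≤ (c : ENNReal) * tripleEnergy d 1 α μ := by
  set a := permUpperConst d n α / permLowerConst d 1 α
  set b := permUpperConst d 1 α / permLowerConst d n α
  set c : NNReal := max 1 (max a.toNNReal b.toNNReal)
  have hac : a ≤ c := (Real.le_coe_toNNReal a).trans
    (NNReal.coe_le_coe.2 ((le_max_left _ _).trans (le_max_right _ _)))
  have hbc : b ≤ c := (Real.le_coe_toNNReal b).trans
    (NNReal.coe_le_coe.2 ((le_max_right _ _).trans (le_max_right _ _)))
  have h1c : 1 ≤ c := le_max_left _ _
  refine ⟨c, h1c, fun μ => ⟨?_, ?_⟩⟩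
  · rw [ENNReal.inv_mul_le_iff (by positivity) ENNReal.coe_ne_top]
    exact tripleEnergy_le_mul
      (permTot_le_mul_permTot hd le_rfl hn hα0 hα1 c.coe_nonneg hbc) μ
  · exact tripleEnergy_le_mul
      (permTot_le_mul_permTot hd hn le_rfl hα0 hα1 c.coe_nonneg hac) μ
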